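/- There exists an absolute constant C > 0 with the following property. Let t > 0 and let f : ℝ² → ℂ be a function whose Fourier transform f̂ belongs to L¹(ℝ²) (so that f is given a.e. by Fourier inversion, f(x) = ∫_{ℝ²} f̂(ξ) e^{i ξ·x} dξ up to normalization), and suppose K := ∫_{ℝ²} |f̂(ξ)|² |ξ|² (1 + t|ξ|²) dξ < ∞. Then for all x, y ∈ ℝ², |f(x) − f(y)| ≤ C K^{1/2} [ln(2 + |x−y|/√t)]^{1/2}. -/

import Mathlib

open MeasureTheory

local notation "E2" => EuclideanSpace ℝ (Fin 2)

/-- The radial majorant weight. -/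
noncomputable def lmcW (c t s : ℝ) : ℝ := 16 * (c - t) / ((1 + c * s ^ 2) * (1 + t * s ^ 2))

theorem lmc_tendsto {c t : ℝ} (hc : 0 < c) (ht : 0 < t) :
    Filter.Tendsto (fun s : ℝ => 8 * (Real.log (1 + c * s ^ 2) - Real.log (1 + t * s ^ 2)))
      Filter.atTop (nhds (8 * Real.log (c / t))) := by
  apply Filter.Tendsto.const_mul
  have h2 : Filter.Tendsto (fun s : ℝ => (s ^ 2)⁻¹) Filter.atTop (nhds 0) :=
    (Filter.tendsto_pow_atTop (two_ne_zero)).inv_tendsto_atTop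
  have h3 : Filter.Tendsto (fun s : ℝ => ((s ^ 2)⁻¹ + c) / ((s ^ 2)⁻¹ + t)) Filter.atTop
      (nhds ((0 + c) / (0 + t))) :=
    (h2.add_const c).div (h2.add_const t) (by linarith)
  rw [zero_add, zero_add] at h3
  have h4 := h3.log (by positivity)
  refine h4.congr' ?_
  filter_upwards [Filter.eventually_gt_atTop 0] with s hs
  rw [← Real.log_div (by positivity) (by positivity)]
  congr 1
  field_simp

theorem lmc_deriv {c t : ℝ} (hc : 0 < c) (ht : 0 < t) (s : ℝ) :
    HasDerivAt (fun s : ℝ => 8 * (Real.log (1 + c * s ^ 2) - Real.log (1 + t * s ^ 2)))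
      (s * lmcW c t s) s := by
  have h (a : ℝ) (ha : 0 < a) : HasDerivAt (fun s : ℝ => Real.log (1 + a * s ^ 2))
      ((a * (2 * s)) / (1 + a * s ^ 2)) s := by
    have h1 : HasDerivAt (fun s : ℝ => 1 + a * s ^ 2) (a * (2 * s)) s := by
      simpa using ((hasDerivAt_pow 2 s).const_mul a).const_add 1
    exact h1.log (by positivity)
  refine (((h c hc).sub (h t ht)).const_mul 8).congr_deriv ?_
  have h1 : 1 + c * s ^ 2 ≠ 0 := by positivity
  have h2 : 1 + t * s ^ 2 ≠ 0 := by positivity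
  unfold lmcW
  field_simp
  ring

theorem lmcW_nonneg {c t : ℝ} (ht : 0 < t) (hct : t ≤ c) (s : ℝ) : 0 ≤ lmcW c t s := by
  have : 0 ≤ c - t := by linarith
  have : 0 < c := by linarith
  unfold lmcW
  positivity

theorem lmc_integrable {c t : ℝ} (ht : 0 < t) (hct : t ≤ c) :
    Integrable (fun ξ : E2 => lmcW c t ‖ξ‖) := by
  have hc : 0 < c := by linarith
  rw [integrable_fun_norm_addHaar (volume : Measure E2) (f := lmcW c t)]
  simpa using integrableOn_Ioi_deriv_of_nonneg' (a := 0) (fun s _ => lmc_deriv hc ht s)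
    (fun s hs => mul_nonneg (le_of_lt hs) (lmcW_nonneg ht hct s)) (lmc_tendsto hc ht)

theorem lmc_integral {c t : ℝ} (ht : 0 < t) (hct : t ≤ c) :
    ∫ ξ : E2, lmcW c t ‖ξ‖ =
      16 * (volume : Measure E2).real (Metric.ball 0 1) * Real.log (c / t) := by
  have hc : 0 < c := by linarith
  rw [integral_fun_norm_addHaar (volume : Measure E2) (lmcW c t)]
  have := integral_Ioi_of_hasDerivAt_of_nonneg' (a := 0) (fun s _ => lmc_deriv hc ht s)
    (fun s hs => mul_nonneg (le_of_lt hs) (lmcW_nonneg ht hct s)) (lmc_tendsto hc ht)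
  simp at this
  simp [this]
  ring

theorem lmc_major {r t c s q : ℝ} (ht : 0 < t) (hct : 2 * t ≤ c) (hrc : r ^ 2 ≤ 4 * c)
    (hs : 0 ≤ s) (hq : 0 ≤ q) (hq2 : q ≤ 2) (hqr : q ≤ r * s) :
    q ^ 2 ≤ s ^ 2 * (1 + t * s ^ 2) * lmcW c t s := by
  have hc : 0 < c := by linarith
  have e : s ^ 2 * (1 + t * s ^ 2) * lmcW c t s = 16 * s ^ 2 * (c - t) / (1 + c * s ^ 2) := by
    unfold lmcW
    have h1 : 1 + c * s ^ 2 ≠ 0 := by positivity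
    have h2 : 1 + t * s ^ 2 ≠ 0 := by positivity
    field_simp
  rw [e, le_div_iff₀ (by positivity)]
  have h1 : q ^ 2 ≤ 4 := by nlinarith
  have h2 : q ^ 2 ≤ 4 * (c * s ^ 2) := by
    calc q ^ 2 ≤ (r * s) ^ 2 := by gcongr
      _ = r ^ 2 * s ^ 2 := by ring
      _ ≤ 4 * c * s ^ 2 := by gcongr
      _ = _ := by ring
  have h3 : q ^ 2 * (c * s ^ 2) ≤ 4 * (c * s ^ 2) := by gcongr
  have h4 : 0 ≤ s ^ 2 * (c - 2 * t) := mul_nonneg (sq_nonneg s) (by linarith)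
  nlinarith

theorem lmc_cs {φ ψ : E2 → ℝ} (hφ : ∀ x, 0 ≤ φ x) (hψ : ∀ x, 0 ≤ ψ x)
    (mφ : MemLp φ 2) (mψ : MemLp ψ 2) :
    ∫ x, φ x * ψ x ≤ Real.sqrt (∫ x, φ x ^ 2) * Real.sqrt (∫ x, ψ x ^ 2) := by
  have := integral_mul_le_Lp_mul_Lq_of_nonneg (μ := (volume : Measure E2))
    Real.HolderConjugate.two_two (f := φ) (g := ψ) (Filter.Eventually.of_forall hφ)
    (Filter.Eventually.of_forall hψ) (by simpa using mφ) (by simpa using mψ)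
  simpa [Real.sqrt_eq_rpow] using this

theorem lmc_exp (ξ x y : E2) :
    ‖Complex.exp (Complex.I * ((inner ℝ ξ x : ℝ) : ℂ)) -
      Complex.exp (Complex.I * ((inner ℝ ξ y : ℝ) : ℂ))‖ ≤ min 2 (‖x - y‖ * ‖ξ‖) := by
  apply le_min
  · refine (norm_sub_le _ _).trans ?_
    rw [Complex.norm_exp_I_mul_ofReal, Complex.norm_exp_I_mul_ofReal]
    norm_num
  · have e : Complex.exp (Complex.I * ((inner ℝ ξ x : ℝ) : ℂ)) -
      Complex.exp (Complex.I * ((inner ℝ ξ y : ℝ) : ℂ)) =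
      Complex.exp (Complex.I * ((inner ℝ ξ y : ℝ) : ℂ)) *
        (Complex.exp (Complex.I * ((inner ℝ ξ (x - y) : ℝ) : ℂ)) - 1) := by
      rw [mul_sub, ← Complex.exp_add, inner_sub_right, mul_one]
      congr 2
      push_cast
      ring
    rw [e, norm_mul, Complex.norm_exp_I_mul_ofReal, one_mul]
    refine Real.norm_exp_I_mul_ofReal_sub_one_le.trans ?_
    rw [mul_comm]
    exact norm_inner_le_norm ξ (x - y)

theorem lmc_int {g : E2 → ℂ} (hg : Integrable g) (x : E2) :
    Integrable (fun ξ : E2 => g ξ * Complex.exp (Complex.I * ((inner ℝ ξ x : ℝ) : ℂ))) := by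
  refine hg.mul_bdd (c := 1) ?_ ?_
  · apply Continuous.aestronglyMeasurable
    fun_prop
  · exact Filter.Eventually.of_forall fun ξ => (Complex.norm_exp_I_mul_ofReal _).le

/-- **Logarithmic modulus of continuity from a weighted `L²` bound on the Fourier transform.**
There is an absolute constant `C > 0` such that: for every `t > 0` and every integrable
`g : ℝ² → ℂ` (playing the role of the Fourier transform `f̂` of `f`), if
`f(x) = ∫ g(ξ) e^{i ξ·x} dξ` (Fourier inversion) and
`K := ∫ |g(ξ)|² |ξ|² (1 + t|ξ|²) dξ < ∞`, then for all `x, y`,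
`|f(x) − f(y)| ≤ C K^{1/2} [ln(2 + |x−y|/√t)]^{1/2}`. -/
theorem log_modulus_of_continuity :
    ∃ C : ℝ, 0 < C ∧
      ∀ (t : ℝ), 0 < t →
      ∀ (g : E2 → ℂ), Integrable g →
      Integrable (fun ξ : E2 => ‖g ξ‖ ^ 2 * ‖ξ‖ ^ 2 * (1 + t * ‖ξ‖ ^ 2)) →
      ∀ f : E2 → ℂ,
        (∀ᵐ x : E2, f x = ∫ ξ : E2, g ξ * Complex.exp (Complex.I * ((inner ℝ ξ x : ℝ) : ℂ))) →
        ∀ x y : E2,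
          f x = (∫ ξ : E2, g ξ * Complex.exp (Complex.I * ((inner ℝ ξ x : ℝ) : ℂ))) →
          f y = (∫ ξ : E2, g ξ * Complex.exp (Complex.I * ((inner ℝ ξ y : ℝ) : ℂ))) →
          ‖f x - f y‖ ≤
            C * Real.sqrt (∫ ξ : E2, ‖g ξ‖ ^ 2 * ‖ξ‖ ^ 2 * (1 + t * ‖ξ‖ ^ 2)) *
              Real.sqrt (Real.log (2 + ‖x - y‖ / Real.sqrt t)) := by
  set V := (volume : Measure E2).real (Metric.ball 0 1) with hV
  have hV0 : 0 ≤ V := measureReal_nonneg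
  refine ⟨Real.sqrt (48 * V) + 1, by positivity, ?_⟩
  intro t ht g hg hK f _ x y hx hy
  set r := ‖x - y‖ with hr
  have hr0 : 0 ≤ r := norm_nonneg _
  set c := 2 * (r + Real.sqrt t) ^ 2 with hc
  have hst : 0 < Real.sqrt t := Real.sqrt_pos.2 ht
  have hss : Real.sqrt t ^ 2 = t := Real.sq_sqrt ht.le
  have hrs : 0 ≤ r * Real.sqrt t := by positivity
  have hct : 2 * t ≤ c := by nlinarith
  have hrc : r ^ 2 ≤ 4 * c := by nlinarith
  have htc : t ≤ c := by linarith
  set φ : E2 → ℝ := fun ξ => ‖g ξ‖ * (‖ξ‖ * Real.sqrt (1 + t * ‖ξ‖ ^ 2)) with hφ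
  set ψ : E2 → ℝ := fun ξ => Real.sqrt (lmcW c t ‖ξ‖) with hψ
  have φ0 : ∀ ξ, 0 ≤ φ ξ := fun ξ => by positivity
  have ψ0 : ∀ ξ, 0 ≤ ψ ξ := fun ξ => by positivity
  have φ2 : ∀ ξ, φ ξ ^ 2 = ‖g ξ‖ ^ 2 * ‖ξ‖ ^ 2 * (1 + t * ‖ξ‖ ^ 2) := fun ξ => by
    simp only [hφ]
    rw [mul_pow, mul_pow, Real.sq_sqrt (by positivity)]
    ring
  have ψ2 : ∀ ξ, ψ ξ ^ 2 = lmcW c t ‖ξ‖ := fun ξ => Real.sq_sqrt (lmcW_nonneg ht htc _)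
  have mφ : MemLp φ 2 := by
    rw [memLp_two_iff_integrable_sq]
    · simpa only [φ2] using hK
    · refine hg.aestronglyMeasurable.norm.mul ?_
      apply Continuous.aestronglyMeasurable
      fun_prop
  have hWi := lmc_integrable ht htc
  have mψ : MemLp ψ 2 := by
    rw [memLp_two_iff_integrable_sq]
    · simpa only [ψ2] using hWi
    · exact Real.continuous_sqrt.comp_aestronglyMeasurable hWi.aestronglyMeasurable
  have hcs := lmc_cs φ0 ψ0 mφ mψ
  simp only [φ2, ψ2] at hcs
  rw [lmc_integral ht htc] at hcs
  have hmain : ‖f x - f y‖ ≤ ∫ ξ, φ ξ * ψ ξ := by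
    rw [hx, hy, ← integral_sub (lmc_int hg x) (lmc_int hg y)]
    refine norm_integral_le_of_norm_le (mφ.integrable_mul mψ) (Filter.Eventually.of_forall ?_)
    intro ξ
    rw [← mul_sub, norm_mul]
    have hq := lmc_exp ξ x y
    simp only [hφ, hψ, mul_assoc]
    gcongr
    refine hq.trans ?_
    have hm := lmc_major (q := min 2 (‖x - y‖ * ‖ξ‖)) ht hct hrc (norm_nonneg ξ) (by positivity)
      (min_le_left _ _) (min_le_right _ _)
    refine (Real.le_sqrt_of_sq_le hm).trans (le_of_eq ?_)
    rw [Real.sqrt_mul (by positivity), Real.sqrt_mul (by positivity),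
      Real.sqrt_sq (norm_nonneg _), mul_assoc]
  set a := r / Real.sqrt t with ha
  have ha0 : 0 ≤ a := by positivity
  have hlog : Real.log (c / t) ≤ 3 * Real.log (2 + a) := by
    have e : c / t = 2 * (1 + a) ^ 2 := by
      rw [hc, ha]
      nth_rw 2 [← hss]
      field_simp
      ring
    have e2 : 3 * Real.log (2 + a) = Real.log ((2 + a) ^ 3) := by
      rw [Real.log_pow]; norm_num
    rw [e, e2]
    apply Real.log_le_log (by positivity)
    nlinarith [pow_nonneg ha0 3, pow_nonneg ha0 2]
  have hL : 0 ≤ Real.log (2 + a) := Real.log_nonneg (by linarith)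
  have h2 : Real.sqrt (16 * V * Real.log (c / t)) ≤
      (Real.sqrt (48 * V) + 1) * Real.sqrt (Real.log (2 + a)) := by
    calc Real.sqrt (16 * V * Real.log (c / t)) ≤ Real.sqrt (48 * V * Real.log (2 + a)) := by
          apply Real.sqrt_le_sqrt
          nlinarith [mul_le_mul_of_nonneg_left hlog hV0]
      _ = Real.sqrt (48 * V) * Real.sqrt (Real.log (2 + a)) := Real.sqrt_mul (by positivity) _
      _ ≤ _ := by gcongr; linarith
  refine hmain.trans (hcs.trans ?_)
  refine (mul_le_mul_of_nonneg_left h2 (Real.sqrt_nonneg _)).trans (le_of_eq ?_)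
  ring
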